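/- For every ε ∈ (0,1) there exists a constant C = C(ε) > 0 such that the following holds. Let q be a prime power, n ≥ 1, p ≥ 1 an integer, d ≥ 0, and {A_g}_{g∈𝔽_q^n} a collection of subsets of 𝔽_q^n with Σ_g |A_g| ≥ 2^{−d} q^{2n}. Let f = Σ_g 1_{A_g} ∘ 1_{A_g}. If ‖μ_f‖_p ≥ 1 + ε and S = {x ∈ 𝔽_q^n : μ_f(x) > 1 + ε/2}, then there exist M₁, M₂ ⊆ 𝔽_q^n, both of density at least 2^{−C(d+1)p} in 𝔽_q^n, such that ⟨μ_{M₁} ∘ μ_{M₂}, 1_S⟩ ≥ 1 − ε/8. -/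

import Mathlib

open scoped BigOperators Classical

noncomputable section

namespace SkewPaper

variable {G : Type*}

/-- Expectation (average) of `f` over a finite type: `E[f] = (1/|G|) ∑ x, f x`. -/
def expect [Fintype G] (f : G → ℝ) : ℝ := (∑ x, f x) / (Fintype.card G)

/-- Normalized inner product `⟨f, g⟩ = E_{x∈G} f(x) g(x)`. -/
def inprod [Fintype G] (f g : G → ℝ) : ℝ := expect (fun x => f x * g x)

/-- Convolution `(f ∗ g)(x) = E_{y∈G} f(y) g(x − y)`. -/
def conv [Fintype G] [AddCommGroup G] (f g : G → ℝ) : G → ℝ :=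
  fun x => expect (fun y => f y * g (x - y))

/-- Difference convolution `(f ∘ g)(x) = E_{y∈G} f(y) g(x + y)`. -/
def dconv [Fintype G] [AddCommGroup G] (f g : G → ℝ) : G → ℝ :=
  fun x => expect (fun y => f y * g (x + y))

/-- Indicator function `1_A` of a set `A`. -/
def ind (A : Set G) : G → ℝ := Set.indicator A (fun _ => (1 : ℝ))

/-- Normalized indicator `μ_A = (|G|/|A|) · 1_A`. -/
def muSet [Fintype G] (A : Set G) : G → ℝ :=
  fun x => ((Fintype.card G : ℝ) / (Nat.card A : ℝ)) * ind A x

/-- `μ_f = f / E[f]`, the normalization of `f` to have mean 1. -/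
def muFun [Fintype G] (f : G → ℝ) : G → ℝ := fun x => f x / expect f

/-- Weighted `L^p` norm `‖f‖_{p(ν)} = (E_x ν(x) |f(x)|^p)^{1/p}`. -/
def wnorm [Fintype G] (p : ℕ) (ν f : G → ℝ) : ℝ :=
  (expect (fun x => ν x * |f x| ^ p)) ^ ((p : ℝ)⁻¹)

/-- `L^p` norm with respect to the uniform measure. -/
def pnorm [Fintype G] (p : ℕ) (f : G → ℝ) : ℝ := wnorm p (fun _ => 1) f

/-- Sup norm `‖f‖_∞`. -/
def supNorm (f : G → ℝ) : ℝ := ⨆ x, |f x|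

/-- `A` is skew-corner-free: it contains no nontrivial skew corner
`(x,y), (x,y+h), (x+h,y')` with `h ≠ 0`. -/
def IsSkewCornerFree [AddCommGroup G] (A : Set (G × G)) : Prop :=
  ∀ x y y' h : G, (x, y) ∈ A → (x, y + h) ∈ A → (x + h, y') ∈ A → h = 0

/-- The set of quadruples `(x, y, y', h)` forming a skew corner of `A`. -/
def skewCorners [AddCommGroup G] (A : Set (G × G)) : Set (G × G × G × G) :=
  {q | (q.1, q.2.1) ∈ A ∧ (q.1, q.2.1 + q.2.2.2) ∈ A ∧ (q.1 + q.2.2.2, q.2.2.1) ∈ A}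

/-- The column `A_x = {y : (x,y) ∈ A}`. -/
def col (A : Set (G × G)) (x : G) : Set G := {y | (x, y) ∈ A}

/-- A Bohr set datum: a finite frequency set of characters together with a width. -/
structure BohrSet (G : Type*) [AddCommGroup G] where
  freq : Finset (AddChar G ℂ)
  width : ℝ

namespace BohrSet

variable [AddCommGroup G]

/-- The underlying set `Bohr(Γ, φ) = {x : |1 − γ(x)| ≤ φ for all γ ∈ Γ}`. -/
def toSet (B : BohrSet G) : Set G :=
  {x | ∀ γ ∈ B.freq, ‖(1 : ℂ) - γ x‖ ≤ B.width}

/-- The rank `|Γ|` of a Bohr set. -/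
def rank (B : BohrSet G) : ℕ := B.freq.card

/-- The dilate `B_ρ = Bohr(Γ, ρφ)`. -/
def dilate (B : BohrSet G) (ρ : ℝ) : BohrSet G := ⟨B.freq, ρ * B.width⟩

/-- `B'` is a sub-Bohr set of `B` (written `B' ≤ B`): its frequency set contains
that of `B` and its width is at most that of `B`. -/
def Sub (B' B : BohrSet G) : Prop := B.freq ⊆ B'.freq ∧ B'.width ≤ B.width

/-- A Bohr set of rank `r` is regular if for all `0 ≤ κ ≤ 1/(100r)`,
`|B_{1+κ}| ≤ (1+100κr)|B|` and `|B_{1−κ}| ≥ (1−100κr)|B|`. -/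
def IsRegular (B : BohrSet G) : Prop :=
  ∀ κ : ℝ, 0 ≤ κ → κ ≤ 1 / (100 * B.rank) →
    ((Nat.card (B.dilate (1 + κ)).toSet : ℝ) ≤ (1 + 100 * κ * B.rank) * (Nat.card B.toSet : ℝ) ∧
     (Nat.card (B.dilate (1 - κ)).toSet : ℝ) ≥ (1 - 100 * κ * B.rank) * (Nat.card B.toSet : ℝ))

/-- The density `μ(B) = |B|/|G|`. -/
def measure [Fintype G] (B : BohrSet G) : ℝ := (Nat.card B.toSet : ℝ) / (Fintype.card G : ℝ)

/-- The normalized indicator measure `μ_B`. -/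
def mu [Fintype G] (B : BohrSet G) : G → ℝ := muSet B.toSet

end BohrSet


/-- (r, λ)-simultaneously spread collection of subsets of 𝔽_q^n. -/
def SimSpread {F : Type*} [Field F] [Fintype F] {n : ℕ} {ι : Type*} [Fintype ι]
    (A : ι → Set (Fin n → F)) (r : ℕ) (lam : ℝ) : Prop :=
  ∀ V : Submodule F (Fin n → F), n ≤ Module.finrank F V + r →
    ∀ x : ι → Fin n → F,
      ∑ i, ((Nat.card ↥(((fun a => a - x i) '' A i) ∩ (V : Set (Fin n → F))) : ℝ) /
            (Nat.card (V : Set (Fin n → F)) : ℝ)) ^ 2 ≤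
        lam * ∑ i, ((Nat.card (A i) : ℝ) / ((Fintype.card F : ℝ) ^ n)) ^ 2

/-- (r, λ)-simultaneously spread in an ambient subspace `W`. -/
def SimSpreadIn {F : Type*} [Field F] [Fintype F] {n : ℕ} {ι : Type*} [Fintype ι]
    (W : Submodule F (Fin n → F)) (A : ι → Set (Fin n → F)) (r : ℕ) (lam : ℝ) : Prop :=
  ∀ V : Submodule F (Fin n → F), V ≤ W → Module.finrank F W ≤ Module.finrank F V + r →
    ∀ x : ι → Fin n → F, (∀ i, x i ∈ W) →
      ∑ i, ((Nat.card ↥(((fun a => a - x i) '' A i) ∩ (V : Set (Fin n → F))) : ℝ) /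
            (Nat.card (V : Set (Fin n → F)) : ℝ)) ^ 2 ≤
        lam * ∑ i, ((Nat.card (A i) : ℝ) / (Nat.card (W : Set (Fin n → F)) : ℝ)) ^ 2

/-- (r, δ, λ)-simultaneously spread collection of subsets of a regular Bohr set `B`. -/
def SimSpreadBohr {G : Type*} [AddCommGroup G] [Fintype G] {ι : Type*} [Fintype ι]
    (B : BohrSet G) (A : ι → Set G) (r : ℕ) (δ lam : ℝ) : Prop :=
  ∀ B' : BohrSet G, B'.Sub B → B'.IsRegular → B'.rank ≤ B.rank + r →
    δ * B.measure ≤ B'.measure →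
    ∀ x : ι → G,
      ∑ i, ((Nat.card ↥(((fun a => a - x i) '' A i) ∩ B'.toSet) : ℝ) /
            (Nat.card B'.toSet : ℝ)) ^ 2 ≤
        lam * ∑ i, ((Nat.card (A i) : ℝ) / (Nat.card B.toSet : ℝ)) ^ 2

lemma ind_nonneg (M : Set G) (x : G) : 0 ≤ ind M x :=
  Set.indicator_nonneg (fun _ _ => zero_le_one) x

lemma sum_ind [Fintype G] (M : Set G) : ∑ x, ind M x = (Nat.card M : ℝ) := by
  rw [Nat.card_eq_fintype_card, Fintype.card_subtype]
  simp [ind, Set.indicator_apply]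

/-- The set of `t` such that `t + s ∈ A g` for every pair `(g, s)` of the tuple `w`. -/
def sift [AddCommGroup G] (A : G → Set G) {k : ℕ} (w : Fin k → G × G) : Set G :=
  {t | ∀ i, t + (w i).2 ∈ A (w i).1}

lemma ind_sift [AddCommGroup G] (A : G → Set G) {k : ℕ} (w : Fin k → G × G) (t : G) :
    ind (sift A w) t = ∏ i, ind (A (w i).1) (t + (w i).2) := by
  simp only [ind, Set.indicator_apply, sift, Set.mem_ofPred_eq]
  rw [Finset.prod_ite_zero]
  simp

section Sifting

variable [Fintype G] [AddCommGroup G]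

/-- The unnormalized autocorrelation of a set. -/
def autocorr (M : Set G) (x : G) : ℝ := ∑ t, ind M t * ind M (x + t)

lemma autocorr_nonneg (M : Set G) (x : G) : 0 ≤ autocorr M x :=
  Finset.sum_nonneg fun _ _ => mul_nonneg (ind_nonneg _ _) (ind_nonneg _ _)

lemma sum_autocorr (M : Set G) : ∑ x, autocorr M x = (Nat.card M : ℝ) ^ 2 := by
  unfold autocorr
  rw [Finset.sum_comm]
  simp_rw [← Finset.mul_sum]
  have h : ∀ t : G, ∑ x, ind M (x + t) = (Nat.card M : ℝ) := fun t => by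
    rw [← sum_ind M]
    exact Equiv.sum_comp (Equiv.addRight t) (ind M)
  simp_rw [h]
  rw [← Finset.sum_mul, sum_ind, sq]

lemma sum_autocorr_sift (A : G → Set G) (k : ℕ) (x : G) :
    ∑ w : Fin k → G × G, autocorr (sift A w) x =
      (Fintype.card G : ℝ) ^ (k + 1) * (∑ g, dconv (ind (A g)) (ind (A g)) x) ^ k := by
  have hN : (Fintype.card G : ℝ) ≠ 0 := by exact_mod_cast Fintype.card_ne_zero
  have key : ∀ t : G, ∑ w : Fin k → G × G, ind (sift A w) t * ind (sift A w) (x + t) =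
      ((Fintype.card G : ℝ) * ∑ g, dconv (ind (A g)) (ind (A g)) x) ^ k := by
    intro t
    simp_rw [ind_sift, ← Finset.prod_mul_distrib]
    rw [← Fintype.sum_pow (fun v : G × G => ind (A v.1) (t + v.2) * ind (A v.1) (x + t + v.2)),
      Fintype.sum_prod_type, Finset.mul_sum]
    congr 1
    refine Finset.sum_congr rfl fun g _ => ?_
    rw [dconv, expect, mul_div_cancel₀ _ hN]
    simp_rw [add_assoc]
    exact Equiv.sum_comp (Equiv.addLeft t) (fun y => ind (A g) y * ind (A g) (x + y))
  unfold autocorr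
  rw [Finset.sum_comm]
  simp_rw [key]
  rw [Finset.sum_const, Finset.card_univ, nsmul_eq_mul, mul_pow]
  ring

lemma inprod_dconv_muSet (M S : Set G) :
    inprod (dconv (muSet M) (muSet M)) (ind S) =
      (∑ x, autocorr M x * ind S x) / (Nat.card M : ℝ) ^ 2 := by
  have hN : (Fintype.card G : ℝ) ≠ 0 := by exact_mod_cast Fintype.card_ne_zero
  have h : ∀ x, dconv (muSet M) (muSet M) x =
      (Fintype.card G : ℝ) / (Nat.card M : ℝ) ^ 2 * autocorr M x := by
    intro x
    simp only [dconv, expect, muSet, autocorr]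
    rw [Finset.sum_div, Finset.mul_sum]
    refine Finset.sum_congr rfl fun t _ => ?_
    field_simp
  simp only [inprod, expect, h, mul_assoc]
  rw [← Finset.mul_sum]
  field_simp

lemma expect_sum_dconv (A : G → Set G) :
    expect (fun y => ∑ g, dconv (ind (A g)) (ind (A g)) y) =
      ∑ g, ((Nat.card (A g) : ℝ) / Fintype.card G) ^ 2 := by
  rw [expect, Finset.sum_comm, Finset.sum_div]
  refine Finset.sum_congr rfl fun g _ => ?_
  have h : ∀ y, dconv (ind (A g)) (ind (A g)) y = autocorr (A g) y / Fintype.card G :=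
    fun _ => rfl
  simp_rw [h]
  rw [← Finset.sum_div, sum_autocorr, div_div, div_pow, sq (Fintype.card G : ℝ)]

lemma le_expect_sum_dconv (A : G → Set G) {D : ℝ} (hD : 0 ≤ D)
    (hA : D * (Fintype.card G : ℝ) ^ 2 ≤ ∑ g, (Nat.card (A g) : ℝ)) :
    D ^ 2 * Fintype.card G ≤ expect (fun y => ∑ g, dconv (ind (A g)) (ind (A g)) y) := by
  have hN : 0 < (Fintype.card G : ℝ) := by exact_mod_cast Fintype.card_pos
  rw [expect_sum_dconv]
  simp_rw [div_pow]
  rw [← Finset.sum_div, le_div_iff₀ (by positivity)]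
  have h1 := sq_sum_le_card_mul_sum_sq (s := (Finset.univ : Finset G))
    (f := fun g => (Nat.card (A g) : ℝ))
  rw [Finset.card_univ] at h1
  have h2 := pow_le_pow_left₀ (by positivity) hA 2
  have h3 := h2.trans h1
  refine le_of_mul_le_mul_left (le_trans (le_of_eq ?_) h3) hN
  ring

/-- If the tuples sifting to a set of density below `δ` are negligible and `f ^ k` is concentrated
on `S`, then some sifted set is dense and its autocorrelation is concentrated on `S`. -/
lemma exists_sift (A : G → Set G) (k : ℕ) {η δ : ℝ} (hη : 0 < η) (S : Set G) {f : G → ℝ}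
    (hf : f = fun y => ∑ g, dconv (ind (A g)) (ind (A g)) y)
    (hS : ∑ x, f x ^ k * (1 - ind S x) ≤ η / 2 * ∑ x, f x ^ k)
    (hδ : 2 * (δ ^ 2 * (Fintype.card G : ℝ) ^ (k + 1)) < ∑ x, f x ^ k) (hδ0 : 0 < δ) :
    ∃ M : Set G, δ ≤ (Nat.card M : ℝ) / Fintype.card G ∧
      1 - η ≤ inprod (dconv (muSet M) (muSet M)) (ind S) := by
  have hN : 0 < (Fintype.card G : ℝ) := by exact_mod_cast Fintype.card_pos
  by_contra! hcon
  have hpt : ∀ w : Fin k → G × G, η * ∑ x, autocorr (sift A w) x ≤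
      ∑ x, autocorr (sift A w) x * (1 - ind S x) + η * (δ ^ 2 * (Fintype.card G : ℝ) ^ 2) := by
    intro w
    have hnn : 0 ≤ ∑ x, autocorr (sift A w) x * (1 - ind S x) :=
      Finset.sum_nonneg fun x _ => mul_nonneg (autocorr_nonneg _ _) (by
        by_cases hx : x ∈ S <;> simp [ind, hx])
    by_cases hw : δ ≤ (Nat.card (sift A w) : ℝ) / Fintype.card G
    · have h := hcon _ hw
      have hm : 0 < (Nat.card (sift A w) : ℝ) :=
        lt_of_lt_of_le (by positivity) ((le_div_iff₀ hN).1 hw)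
      rw [inprod_dconv_muSet, div_lt_iff₀ (by positivity), ← sum_autocorr] at h
      simp_rw [mul_sub, mul_one]
      rw [Finset.sum_sub_distrib]
      have : 0 ≤ η * (δ ^ 2 * (Fintype.card G : ℝ) ^ 2) := by positivity
      linarith
    · rw [not_le, div_lt_iff₀ hN] at hw
      rw [sum_autocorr, ← mul_pow]
      have := mul_le_mul_of_nonneg_left (pow_le_pow_left₀ (Nat.cast_nonneg _) hw.le 2) hη.le
      linarith
  have hswap : ∀ φ : G → ℝ, ∑ w : Fin k → G × G, ∑ x, autocorr (sift A w) x * φ x =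
      (Fintype.card G : ℝ) ^ (k + 1) * ∑ x, f x ^ k * φ x := by
    intro φ
    rw [Finset.sum_comm, Finset.mul_sum]
    refine Finset.sum_congr rfl fun x _ => ?_
    rw [← Finset.sum_mul, sum_autocorr_sift, hf, mul_assoc]
  have hsum := Finset.sum_le_sum fun w (_ : w ∈ Finset.univ) => hpt w
  have h1 := hswap fun _ => 1
  simp only [mul_one] at h1
  rw [← Finset.mul_sum, h1, Finset.sum_add_distrib, hswap, Finset.sum_const, Finset.card_univ,
    Fintype.card_fun, Fintype.card_prod, Fintype.card_fin, nsmul_eq_mul] at hsum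
  push_cast at hsum
  have hP : 0 < (Fintype.card G : ℝ) ^ (k + 1) := by positivity
  have h2 := mul_le_mul_of_nonneg_left hS hP.le
  have h3 := mul_lt_mul_of_pos_left hδ (mul_pos hη hP)
  have h4 : ((Fintype.card G : ℝ) * Fintype.card G) ^ k *
      (η * (δ ^ 2 * (Fintype.card G : ℝ) ^ 2)) =
      η * (Fintype.card G : ℝ) ^ (k + 1) * (δ ^ 2 * (Fintype.card G : ℝ) ^ (k + 1)) := by
    ring
  rw [h4] at hsum
  linarith

end Sifting

section Norms

variable [Fintype G]

lemma expect_pow_le [Nonempty G] (h : G → ℝ) (hh : ∀ x, 0 ≤ h x) (K : ℕ) :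
    expect h ^ K ≤ expect (fun x => h x ^ K) := by
  have hN : (Fintype.card G : ℝ) ≠ 0 := by exact_mod_cast Fintype.card_ne_zero
  rcases K with _ | K
  · simp [expect, hN]
  · have h1 := pow_sum_div_card_le_sum_pow (s := Finset.univ) (n := K) (fun x _ => hh x)
    rw [Finset.card_univ] at h1
    unfold expect
    rw [div_pow, pow_succ (Fintype.card G : ℝ), ← div_div]
    gcongr

lemma pow_le_sum_pow_of_le_pnorm [Nonempty G] {f : G → ℝ} (hf : ∀ x, 0 ≤ f x) (hE : 0 < expect f)
    {p : ℕ} (hp : 1 ≤ p) {r : ℝ} (hr : 0 ≤ r) (h : r ≤ pnorm p (muFun f)) (K : ℕ) :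
    Fintype.card G * (r * expect f) ^ (p * K) ≤ ∑ x, f x ^ (p * K) := by
  have hN : 0 < (Fintype.card G : ℝ) := by exact_mod_cast Fintype.card_pos
  have hmu : ∀ x, 0 ≤ muFun f x := fun x => div_nonneg (hf x) hE.le
  have h1 : r ^ p ≤ expect fun x => muFun f x ^ p := by
    have h2 := pow_le_pow_left₀ hr h p
    rw [pnorm, wnorm, Real.rpow_inv_natCast_pow _ (by omega)] at h2
    · simpa only [one_mul, abs_of_nonneg (hmu _)] using h2
    · exact div_nonneg (Finset.sum_nonneg fun x _ => by positivity) hN.le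
  have h2 := (pow_le_pow_left₀ (by positivity) h1 K).trans
    (expect_pow_le _ (fun x => pow_nonneg (hmu x) p) K)
  simp_rw [← pow_mul] at h2
  simp only [muFun, div_pow] at h2
  rw [expect, ← Finset.sum_div, div_div, le_div_iff₀ (by positivity)] at h2
  rw [mul_pow]
  linarith

lemma sum_pow_mul_one_sub_ind_le {f : G → ℝ} (hf : ∀ x, 0 ≤ f x) (hE : 0 < expect f)
    {r : ℝ} (hr : 0 ≤ r) (k : ℕ) :
    ∑ x, f x ^ k * (1 - ind {x | r < muFun f x} x) ≤ Fintype.card G * (r * expect f) ^ k := by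
  rw [← nsmul_eq_mul, ← Finset.card_univ, ← Finset.sum_const]
  refine Finset.sum_le_sum fun x _ => ?_
  by_cases hx : r < muFun f x
  · simp only [ind, Set.indicator_apply, Set.mem_ofPred_eq, hx, if_true, sub_self, mul_zero]
    positivity
  · simp only [ind, Set.indicator_apply, Set.mem_ofPred_eq, hx, if_false, sub_zero, mul_one]
    exact pow_le_pow_left₀ (hf x) ((div_le_iff₀ hE).1 (not_lt.1 hx)) k

end Norms

theorem statement14 (ε : ℝ) (hε0 : 0 < ε) (hε1 : ε < 1) :
    ∃ C : ℝ, 0 < C ∧ ∀ (F : Type) [Field F] [Fintype F], ∀ n : ℕ, 1 ≤ n →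
      ∀ p : ℕ, 1 ≤ p → ∀ d : ℝ, 0 ≤ d →
      ∀ A : (Fin n → F) → Set (Fin n → F),
        (2 : ℝ) ^ (-d) * (Fintype.card F : ℝ) ^ (2 * n) ≤ ∑ g, (Nat.card (A g) : ℝ) →
      ∀ f : (Fin n → F) → ℝ, f = (fun y => ∑ g, dconv (ind (A g)) (ind (A g)) y) →
        1 + ε ≤ pnorm p (muFun f) →
      ∀ S : Set (Fin n → F), S = {x | 1 + ε / 2 < muFun f x} →
        ∃ M₁ M₂ : Set (Fin n → F),
          (2 : ℝ) ^ (-(C * (d + 1) * p)) ≤ (Nat.card M₁ : ℝ) / (Fintype.card F : ℝ) ^ n ∧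
          (2 : ℝ) ^ (-(C * (d + 1) * p)) ≤ (Nat.card M₂ : ℝ) / (Fintype.card F : ℝ) ^ n ∧
          1 - ε / 8 ≤ inprod (dconv (muSet M₁) (muSet M₂)) (ind S) := by
  obtain ⟨K, hK⟩ := exists_pow_lt_of_lt_one (show 0 < ε / 16 by positivity)
    (show (1 + ε / 2) / (1 + ε) < 1 by rw [div_lt_one (by linarith)]; linarith)
  refine ⟨K + 1, by positivity, ?_⟩
  intro F _ _ n _ p hp d hd A hA f hf hnorm S hS
  have hcard : (Fintype.card F : ℝ) ^ n = Fintype.card (Fin n → F) := by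
    rw [Fintype.card_fun, Fintype.card_fin]; push_cast; rfl
  rw [mul_comm 2 n, pow_mul, hcard] at hA
  rw [hcard]
  have hN : 0 < (Fintype.card (Fin n → F) : ℝ) := by exact_mod_cast Fintype.card_pos
  have hf0 : ∀ x, 0 ≤ f x := fun x => by
    rw [hf]
    exact Finset.sum_nonneg fun g _ => div_nonneg (autocorr_nonneg (A g) x) hN.le
  have hD : (0 : ℝ) < 2 ^ (-d) := by positivity
  have hE := le_expect_sum_dconv A hD.le hA
  rw [← hf] at hE
  have hE0 : 0 < expect f := lt_of_lt_of_le (by positivity) hE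
  have hlow := pow_le_sum_pow_of_le_pnorm hf0 hE0 hp (by linarith) hnorm K
  have hratio : (1 + ε / 2) ^ (p * K) ≤ ε / 16 * (1 + ε) ^ (p * K) := by
    have h1 : ((1 + ε / 2) / (1 + ε)) ^ (p * K) ≤ ε / 16 :=
      (pow_le_pow_of_le_one (by positivity)
        (by rw [div_le_one (by linarith)]; linarith) (Nat.le_mul_of_pos_left K hp)).trans hK.le
    rwa [div_pow, div_le_iff₀ (by positivity)] at h1
  have hδ : (2 : ℝ) ^ (-((K + 1) * (d + 1) * p)) ≤ (2 ^ (-d)) ^ (p * K) / 2 := by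
    have hp' : (1 : ℝ) ≤ p := by exact_mod_cast hp
    have hK0 : (0 : ℝ) ≤ K := by positivity
    rw [← Real.rpow_natCast, ← Real.rpow_mul zero_le_two, div_eq_mul_inv, ← Real.rpow_neg_one,
      ← Real.rpow_add two_pos]
    refine Real.rpow_le_rpow_of_exponent_le one_le_two ?_
    push_cast
    have h1 : 0 ≤ (K : ℝ) * p := by positivity
    have h2 : 0 ≤ d * p := by positivity
    linarith
  obtain ⟨M, hM, hM'⟩ := exists_sift A (p * K) (η := ε / 8) (by positivity) S hf (by
    rw [hS]
    refine (sum_pow_mul_one_sub_ind_le hf0 hE0 (by positivity) _).trans ?_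
    refine le_trans ?_ (mul_le_mul_of_nonneg_left hlow (by positivity))
    rw [mul_pow, mul_pow]
    have := mul_le_mul_of_nonneg_left hratio
      (show 0 ≤ Fintype.card (Fin n → F) * expect f ^ (p * K) by positivity)
    linarith) (δ := 2 ^ (-((K + 1) * (d + 1) * p))) (by
    refine lt_of_lt_of_le ?_ hlow
    have h1 := pow_le_pow_left₀ (by positivity) hδ 2
    have h2 : (2 ^ (-d)) ^ (p * K * 2) * (Fintype.card (Fin n → F) : ℝ) ^ (p * K) ≤
        ((1 + ε) * expect f) ^ (p * K) := by
      rw [mul_comm (p * K) 2, pow_mul, ← mul_pow]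
      refine pow_le_pow_left₀ (by positivity) (hE.trans ?_) _
      exact le_mul_of_one_le_left hE0.le (by linarith)
    rw [div_pow, ← pow_mul] at h1
    have h3 := mul_le_mul_of_nonneg_left h1
      (show 0 ≤ (Fintype.card (Fin n → F) : ℝ) ^ (p * K + 1) by positivity)
    have h4 := mul_le_mul_of_nonneg_left h2 hN.le
    have h5 : 0 < (2 ^ (-d)) ^ (p * K * 2) * (Fintype.card (Fin n → F) : ℝ) ^ (p * K + 1) := by
      positivity
    rw [pow_succ _ (p * K)] at h3 h5 ⊢
    linarith) (by positivity)
  exact ⟨M, M, hM, hM, hM'⟩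

end SkewPaper
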